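/- For every real ε one has P(1/2, ε) = (9/8)ε²(ε − 4)², and for every ε with 0 < ε ≤ 1 every real root of the cubic z ↦ P(z, ε) is strictly less than 1/2. -/

import Mathlib

/-- The cubic polynomial `P(z, ε)`. -/
def Pcub (z ε : ℝ) : ℝ :=
  (ε ^ 4 + 16 * ε ^ 2 + 64) * z ^ 3
    + (2 * ε ^ 4 - 20 * ε ^ 3 - 24 * ε ^ 2 + 160 * ε - 64) * z ^ 2
    + (ε ^ 4 - 16 * ε ^ 3 + 84 * ε ^ 2 - 112 * ε + 16) * z
    + ε * (4 * ε ^ 2 - 20 * ε + 16)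

/-- The Taylor expansion of `Pcub` in `z` about `1 / 2`. -/
theorem Pcub_half_add (w ε : ℝ) :
    Pcub (1 / 2 + w) ε =
      (ε ^ 4 + 16 * ε ^ 2 + 64) * w ^ 3
        + (7 / 2 * ε ^ 4 - 20 * ε ^ 3 + 160 * ε + 32) * w ^ 2
        + ε * (15 / 4 * ε ^ 3 - 36 * ε ^ 2 + 72 * ε + 48) * w
        + 9 / 8 * ε ^ 2 * (ε - 4) ^ 2 := by
  unfold Pcub
  ring

theorem Pcub_half_add_pos {w ε : ℝ} (hw : 0 ≤ w) (hε : 0 < ε) (hε1 : ε ≤ 1) :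
    0 < Pcub (1 / 2 + w) ε := by
  have hsq : ε ^ 2 ≤ ε := by nlinarith
  have hcube : ε ^ 3 ≤ ε := by nlinarith
  have hquad : 0 ≤ 7 / 2 * ε ^ 4 - 20 * ε ^ 3 + 160 * ε + 32 := by
    have : 0 < ε ^ 4 := by positivity
    linarith
  have hlin : 0 ≤ 15 / 4 * ε ^ 3 - 36 * ε ^ 2 + 72 * ε + 48 := by
    have : 0 < ε ^ 3 := by positivity
    linarith
  have hconst : 0 < (ε - 4) ^ 2 := by nlinarith
  rw [Pcub_half_add]
  positivity

/-- `P(1/2, ε) = (9/8)ε²(ε − 4)²` for every real `ε`, and for `0 < ε ≤ 1` every real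
root of the cubic `z ↦ P(z, ε)` is strictly less than `1/2`. -/
theorem Pcub_roots_lt_half :
    (∀ ε : ℝ, Pcub (1 / 2) ε = 9 / 8 * ε ^ 2 * (ε - 4) ^ 2) ∧
    (∀ ε : ℝ, 0 < ε → ε ≤ 1 → ∀ z : ℝ, Pcub z ε = 0 → z < 1 / 2) := by
  refine ⟨fun ε => by simpa using Pcub_half_add 0 ε, fun ε hε hε1 z hz => ?_⟩
  by_contra! h
  have hpos := Pcub_half_add_pos (sub_nonneg.mpr h) hε hε1
  rw [add_sub_cancel, hz] at hpos
  exact hpos.false
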